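/- Let Π=(P,L) be a connected partial linear space satisfying conditions (a)–(e) of the Setting. Then in the graph (P,⊥), in which distinct vertices are adjacent when they are ⊥, any two vertices lying in the same connected component are at distance at most 2; that is, every connected component of (P,⊥) has diameter at most 2. -/

import Mathlib

universe u

/-- A *partial linear space*: a set of points `P` together with a set `L` of
subsets of `P` of size at least `2` (the *lines*), such that two distinct
points lie on at most one common line. -/
structure PLS (P : Type u) where
  L : Set (Set P)
  nontrivial_lines : ∀ l ∈ L, Set.Nontrivial l
  unique_line : ∀ l ∈ L, ∀ m ∈ L, ∀ x y : P, x ≠ y →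
    x ∈ l → y ∈ l → x ∈ m → y ∈ m → l = m

namespace PLS

variable {P : Type u} (S : PLS P)

/-- `x ∼ y` : the points are distinct and lie on a common line. -/
def Collinear (x y : P) : Prop := x ≠ y ∧ ∃ l ∈ S.L, x ∈ l ∧ y ∈ l

/-- `x ⊥ y` : `x = y` or `x` and `y` are non-collinear. -/
def Perp (x y : P) : Prop := ¬ S.Collinear x y

/-- `x^⊥` : the set of points `y` with `x ⊥ y`. -/
def perpSet (x : P) : Set P := {y | S.Perp x y}

/-- Adjacency in the graph `(P, ⊥)` : distinct points with `x ⊥ y`. -/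
def PerpAdj (x y : P) : Prop := x ≠ y ∧ S.Perp x y

/-- `X^⊥` for a set `X` of points: points `⊥` to every point of `X`. -/
def setPerp (X : Set P) : Set P := {z | ∀ p ∈ X, S.Perp z p}

/-- `(xy)^{⊥⊥} = {z ∈ P : z ⊥ u for every u ∈ x^⊥ ∩ y^⊥}`. -/
def doublePerp (x y : P) : Set P :=
  {z | ∀ u ∈ S.perpSet x ∩ S.perpSet y, S.Perp z u}

/-- A subspace: every line meeting it in at least two points is contained in it. -/
def IsSubspace (X : Set P) : Prop :=
  ∀ l ∈ S.L, (∃ x ∈ l ∩ X, ∃ y ∈ l ∩ X, x ≠ y) → l ⊆ X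

/-- `⟨Y⟩`, the subspace generated by `Y`. -/
def span (Y : Set P) : Set P := ⋂₀ {X | S.IsSubspace X ∧ Y ⊆ X}

/-- A plane: the subspace generated by two distinct lines meeting in a point. -/
def IsPlane (X : Set P) : Prop :=
  ∃ l ∈ S.L, ∃ m ∈ S.L, l ≠ m ∧ (l ∩ m).Nonempty ∧ X = S.span (l ∪ m)

/-- A transversal plane: a plane `X` such that for every line `ℓ ⊆ X` the sets
`x^⊥ ∩ X`, for `x ∈ ℓ`, partition `X` (every point of `X` lies in exactly one
of them). -/
def IsTransversalPlane (X : Set P) : Prop :=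
  S.IsPlane X ∧ ∀ l ∈ S.L, l ⊆ X → ∀ p ∈ X, ∃! x, x ∈ l ∧ S.Perp x p

/-- `T` is a transversal of `X`: `T = x^⊥ ∩ X` for a point `x` on a line of `X`. -/
def IsTransversalOf (T X : Set P) : Prop :=
  ∃ l ∈ S.L, l ⊆ X ∧ ∃ x ∈ l, T = S.perpSet x ∩ X

/-- Connectedness of the collinearity graph `(P, ∼)`. -/
def Connected : Prop := ∀ x y : P, Relation.ReflTransGen S.Collinear x y

/-- Connectedness of the graph `(P, ⊥)`. -/
def CoConnected : Prop := ∀ x y : P, Relation.ReflTransGen S.PerpAdj x y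

/-- The one-or-all axiom for polar spaces. -/
def IsPolar : Prop :=
  ∀ p : P, ∀ l ∈ S.L, p ∉ l →
    (∃! q, q ∈ l ∧ S.Collinear p q) ∨ (∀ q ∈ l, S.Collinear p q)

/-- Non-degeneracy: the radical is empty, i.e. no point is collinear with all
other points. -/
def Nondegenerate : Prop := ∀ p : P, ∃ q, q ≠ p ∧ ¬ S.Collinear p q

/-- In a polar space, `p^⊥` denotes the points equal or collinear to `p`. -/
def polarPerp (x : P) : Set P := {q | q = x ∨ S.Collinear x q}

/-- `X^⊥` in a polar space, for a set of points `X`. -/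
def polarPerpSet (X : Set P) : Set P := {q | ∀ x ∈ X, q ∈ S.polarPerp x}

/-- The hyperbolic line on two non-collinear points of a polar space:
`{z : z ∈ u^⊥ for every u ∈ x^⊥ ∩ y^⊥}`. -/
def polarHypLine (x y : P) : Set P :=
  {z | ∀ u ∈ S.polarPerp x ∩ S.polarPerp y, z ∈ S.polarPerp u}

/-- A linear set: any two of its distinct points are collinear. -/
def IsLinearSet (X : Set P) : Prop := ∀ x ∈ X, ∀ y ∈ X, x ≠ y → S.Collinear x y

/-- Planarity: any two distinct lines meeting in a point are contained in a
unique plane. -/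
def Planar : Prop :=
  ∀ l ∈ S.L, ∀ m ∈ S.L, l ≠ m → (l ∩ m).Nonempty →
    ∃! π, S.IsPlane π ∧ l ⊆ π ∧ m ⊆ π

/-- A projective plane: a linear space in which any two distinct lines meet in
a point, containing four points no three of which are collinear. -/
def IsProjectivePlane : Prop :=
  (∀ x y : P, x ≠ y → ∃ l ∈ S.L, x ∈ l ∧ y ∈ l) ∧
  (∀ l ∈ S.L, ∀ m ∈ S.L, l ≠ m → (l ∩ m).Nonempty) ∧
  (∃ a b c d : P, a ≠ b ∧ a ≠ c ∧ a ≠ d ∧ b ≠ c ∧ b ≠ d ∧ c ≠ d ∧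
    ∀ l ∈ S.L, ¬(a ∈ l ∧ b ∈ l ∧ c ∈ l) ∧ ¬(a ∈ l ∧ b ∈ l ∧ d ∈ l) ∧
      ¬(a ∈ l ∧ c ∈ l ∧ d ∈ l) ∧ ¬(b ∈ l ∧ c ∈ l ∧ d ∈ l))

/-- `π` is isomorphic to a dual affine plane: there is a projective plane `T`
on a point set `Q`, a point `p` of `T`, and a bijection from `π` onto `Q ∖ {p}`
under which the lines of `Π` contained in `π` correspond exactly to the lines
of `T` not passing through `p`. -/
def IsDualAffine (π : Set P) : Prop :=
  ∃ (Q : Type u) (T : PLS Q) (p : Q) (f : P → Q),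
    T.IsProjectivePlane ∧ Set.BijOn f π {q | q ≠ p} ∧
    ∀ s : Set P, s ⊆ π → (s ∈ S.L ↔ f '' s ∈ T.L ∧ p ∉ f '' s)

/-- A linear plane contains four distinct lines which pairwise meet and whose
pairwise intersection points are six distinct points. -/
def FourLinesSixPoints (π : Set P) : Prop :=
  ∃ l : Fin 4 → Set P, (∀ i, l i ∈ S.L ∧ l i ⊆ π) ∧ Function.Injective l ∧
    ∃ pt : Fin 4 → Fin 4 → P,
      (∀ i j, i < j → pt i j ∈ l i ∩ l j) ∧
      (∀ i j k m, i < j → k < m → (i, j) ≠ (k, m) → pt i j ≠ pt k m)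

/-- Conditions (a)–(d) of the Main Hypothesis, for a connected and co-connected
partial linear space:
(a) all lines have at least `4` points;
(b) `x^⊥ ⊆ y^⊥` implies `x = y`;
(c) every triple `x ∼ y ∼ z`, `x ⊥ z`, `x ≠ z`, generates a transversal plane;
(d) for every point `p` and transversal plane `π`, `p^⊥ ∩ π` is empty, a
point, a line, or a transversal of `π`. -/
def MainHyp : Prop :=
  S.Connected ∧ S.CoConnected ∧
  (∀ l ∈ S.L, 4 ≤ Cardinal.mk ↥l) ∧
  (∀ x y : P, S.perpSet x ⊆ S.perpSet y → x = y) ∧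
  (∀ x y z : P, S.Collinear x y → S.Collinear y z → S.PerpAdj x z →
    S.IsTransversalPlane (S.span {x, y, z})) ∧
  (∀ p : P, ∀ π : Set P, S.IsTransversalPlane π →
    S.perpSet p ∩ π = ∅ ∨ (∃ q, S.perpSet p ∩ π = {q}) ∨
    S.perpSet p ∩ π ∈ S.L ∨ S.IsTransversalOf (S.perpSet p ∩ π) π)

/-- Conditions (a)–(e) of the Setting, for a connected partial linear space:
(a) all lines have at least `4` points;
(b) `x^⊥ ⊆ y^⊥` implies `x^⊥ = y^⊥`;
(c) there exist two distinct non-collinear points;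
(d) every triple `x ∼ y ∼ z`, `x ⊥ z`, `x ≠ z`, is contained in a transversal
plane;
(e) for every point `p` and transversal plane `π`, `p^⊥ ∩ π` is empty, a
point, a line, a transversal of `π`, or `π` itself. -/
def Setting : Prop :=
  S.Connected ∧
  (∀ l ∈ S.L, 4 ≤ Cardinal.mk ↥l) ∧
  (∀ x y : P, S.perpSet x ⊆ S.perpSet y → S.perpSet x = S.perpSet y) ∧
  (∃ x y : P, x ≠ y ∧ ¬ S.Collinear x y) ∧
  (∀ x y z : P, S.Collinear x y → S.Collinear y z → S.PerpAdj x z →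
    ∃ π, S.IsTransversalPlane π ∧ x ∈ π ∧ y ∈ π ∧ z ∈ π) ∧
  (∀ p : P, ∀ π : Set P, S.IsTransversalPlane π →
    S.perpSet p ∩ π = ∅ ∨ (∃ q, S.perpSet p ∩ π = {q}) ∨
    S.perpSet p ∩ π ∈ S.L ∨ S.IsTransversalOf (S.perpSet p ∩ π) π ∨
    S.perpSet p ∩ π = π)

end PLS

namespace PLS

variable {P : Type u} {S : PLS P}

theorem Collinear.sm {x y : P} (h : S.Collinear x y) : S.Collinear y x :=
  ⟨h.1.symm, by obtain ⟨l, hl, a, b⟩ := h.2; exact ⟨l, hl, b, a⟩⟩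

theorem Perp.sm {x y : P} (h : S.Perp x y) : S.Perp y x := fun k => h k.sm

theorem perp_rfl (x : P) : S.Perp x x := fun k => k.1 rfl

theorem perp_line {l : Set P} (hl : l ∈ S.L) {x y : P} (hx : x ∈ l) (hy : y ∈ l)
    (h : S.Perp x y) : x = y := by
  by_contra hne
  exact h ⟨hne, l, hl, hx, hy⟩

theorem plane_sub {π : Set P} (h : S.IsTransversalPlane π) {l : Set P} (hl : l ∈ S.L)
    {x y : P} (hne : x ≠ y) (hx : x ∈ l) (hy : y ∈ l) (hx' : x ∈ π) (hy' : y ∈ π) : l ⊆ π := by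
  obtain ⟨⟨a, ha, b, hb, hab, hn, rfl⟩, _⟩ := h
  intro t ht X hX
  exact hX.1 l hl ⟨x, ⟨hx, hx' X hX⟩, y, ⟨hy, hy' X hX⟩, hne⟩ ht

theorem tr_ex {π : Set P} (h : S.IsTransversalPlane π) {l : Set P} (hl : l ∈ S.L) (hs : l ⊆ π)
    {p : P} (hp : p ∈ π) : ∃ x ∈ l, S.Perp x p := by
  obtain ⟨x, hx, _⟩ := h.2 l hl hs p hp
  exact ⟨x, hx.1, hx.2⟩

theorem tr_un {π : Set P} (h : S.IsTransversalPlane π) {l : Set P} (hl : l ∈ S.L) (hs : l ⊆ π)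
    {p : P} (hp : p ∈ π) {u v : P} (hu : u ∈ l) (hv : v ∈ l) (hu' : S.Perp u p)
    (hv' : S.Perp v p) : u = v :=
  (h.2 l hl hs p hp).unique ⟨hu, hu'⟩ ⟨hv, hv'⟩

/-- two perps of a line in a transversal plane. -/
theorem setting_line (hS : S.Setting) {π : Set P} (h : S.IsTransversalPlane π) {p u v s : P}
    (hu : u ∈ π) (hv : v ∈ π) (hs : s ∈ π) {l : Set P} (hl : l ∈ S.L) (hul : u ∈ l) (hvl : v ∈ l)
    (huv : u ≠ v) (hpu : S.Perp p u) (hpv : S.Perp p v) (hps : ¬ S.Perp p s) :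
    S.perpSet p ∩ π = l := by
  obtain ⟨_, _, _, _, _, he⟩ := hS
  have hu1 : u ∈ S.perpSet p ∩ π := ⟨hpu, hu⟩
  have hv1 : v ∈ S.perpSet p ∩ π := ⟨hpv, hv⟩
  rcases he p π h with h1 | ⟨q, h1⟩ | h1 | ⟨m, hm, hmπ, x, hx, h1⟩ | h1
  · rw [h1] at hu1; exact hu1.elim
  · rw [h1] at hu1 hv1
    exact absurd (hu1.trans hv1.symm) huv
  · exact S.unique_line _ h1 _ hl u v huv hu1 hv1 hul hvl
  · rw [h1] at hu1 hv1
    exact absurd (tr_un h hl (plane_sub h hl huv hul hvl hu hv) (hmπ hx) hul hvl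
      hu1.1.sm hv1.1.sm) huv
  · exact absurd (h1.symm.subset hs).1 hps

theorem veblen (hS : S.Setting) {π : Set P} (h : S.IsTransversalPlane π)
    {j k n n2 : Set P} (hj : j ∈ S.L) (hk : k ∈ S.L) (hn : n ∈ S.L) (hn2 : n2 ∈ S.L)
    {p s s0 r t v : P} (hpj : S.perpSet p ∩ π = j) (hs : s ∈ π)
    (hss : S.Perp s s0) (hne : s ≠ s0) (hs0j : s0 ∈ j) (hs0k : s0 ∈ k) (hkπ : k ⊆ π)
    (hsn : s ∈ n) (hsn2 : s ∈ n2) (hrn : r ∈ n) (hrj : r ∈ j) (htn : t ∈ n) (htk : t ∈ k)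
    (hvn : v ∈ n2) (hvk : v ∈ k) : ∃ c ∈ n2, c ∈ j := by
  have hd := hS.2.2.2.2.1
  have hjπ : j ⊆ π := hpj ▸ Set.inter_subset_right
  have hpp : ∀ c ∈ j, S.Perp p c := fun c hc => (hpj.symm.subset hc).1
  have hsj : s ∉ j := fun hc => hne (perp_line hj hc hs0j hss)
  have hsk : s ∉ k := fun hc => hne (perp_line hk hc hs0k hss)
  have hs0n : s0 ∉ n := fun hc => hne (perp_line hn hsn hc hss)
  have hs0n2 : s0 ∉ n2 := fun hc => hne (perp_line hn2 hsn2 hc hss)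
  have hrs : r ≠ s := by rintro rfl; exact hsj hrj
  have hts : t ≠ s := by rintro rfl; exact hsk htk
  have hvs : v ≠ s := by rintro rfl; exact hsk hvk
  have hrs0 : r ≠ s0 := by rintro rfl; exact hs0n hrn
  have hts0 : t ≠ s0 := by rintro rfl; exact hs0n htn
  have hpnotπ : p ∉ π := by
    intro hp
    have hpinj : p ∈ j := hpj.subset ⟨perp_rfl p, hp⟩
    exact hrs0 (tr_un h hj hjπ hp hrj hs0j (hpp r hrj).sm (hpp _ hs0j).sm)
  have hps : S.Collinear p s := by
    by_contra hc
    exact hsj (hpj.subset ⟨hc, hs⟩)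
  obtain ⟨κ, hκ, hpκ, hsκ, hrκ⟩ := hd p s r hps ⟨hrs.symm, n, hn, hsn, hrn⟩
    ⟨by rintro rfl; exact hpnotπ (hjπ hrj), hpp r hrj⟩
  obtain ⟨_, l, hl, hpl, hsl⟩ := id hps
  have hlκ : l ⊆ κ := plane_sub hκ hl hps.1 hpl hsl hpκ hsκ
  have hnκ : n ⊆ κ := plane_sub hκ hn hrs hrn hsn hrκ hsκ
  have h1 : S.perpSet s0 ∩ κ = l := setting_line hS hκ hpκ hsκ hrκ hl hpl hsl hps.1
    (hpp _ hs0j).sm hss.sm (fun hc => hrs0 (perp_line hj hrj hs0j hc.sm))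
  obtain ⟨q, hql, hqt⟩ := tr_ex hκ hl hlκ (hnκ htn)
  have hqs0 : S.Perp q s0 := Perp.sm (h1.symm.subset hql).1
  have hqs : q ≠ s := by
    rintro rfl
    exact hts (perp_line hn htn hsn hqt.sm)
  have hlπ : ∀ c ∈ l, c ≠ s → c ∉ π := fun c hc hcs hcπ =>
    hpnotπ (plane_sub h hl hcs hc hsl hcπ hs hpl)
  have h2 : S.perpSet q ∩ π = k := setting_line hS h (hkπ hs0k) (hkπ htk) hs hk hs0k htk
    hts0.symm hqs0 hqt (fun hc => hqs (perp_line hl hql hsl hc))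
  have hqv : S.Perp q v := (h2.symm.subset hvk).1
  obtain ⟨κ2, hκ2, hqκ2, hsκ2, hvκ2⟩ := hd q s v ⟨hqs, l, hl, hql, hsl⟩
    ⟨hvs.symm, n2, hn2, hsn2, hvn⟩ ⟨by rintro rfl; exact hlπ _ hql hqs (hkπ hvk), hqv⟩
  have hlκ2 : l ⊆ κ2 := plane_sub hκ2 hl hqs hql hsl hqκ2 hsκ2
  have hn2κ2 : n2 ⊆ κ2 := plane_sub hκ2 hn2 hvs hvn hsn2 hvκ2 hsκ2
  obtain ⟨c, hc, hcp⟩ := tr_ex hκ2 hn2 hn2κ2 (hlκ2 hpl)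
  exact ⟨c, hc, hpj.subset ⟨hcp.sm, plane_sub h hn2 hvs hvn hsn2 (hkπ hvk) hs hc⟩⟩

theorem four_points {l : Set P} (h : 4 ≤ Cardinal.mk ↥l) (x y : P) :
    ∃ z ∈ l, ∃ w ∈ l, z ≠ x ∧ z ≠ y ∧ w ≠ x ∧ w ≠ y ∧ z ≠ w := by
  classical
  have key : ∀ F : Finset P, F.card < 4 → ∃ z ∈ l, z ∉ F := by
    intro F hF
    by_contra! hc
    have h1 : Cardinal.mk ↥l ≤ Cardinal.mk ↥(F : Set P) := Cardinal.mk_le_mk_of_subset hc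
    replace h1 : Cardinal.mk ↥l ≤ (F.card : Cardinal) := h1.trans_eq Cardinal.mk_coe_finset
    have h2 := h.trans h1
    have h3 : 4 ≤ F.card := by exact_mod_cast h2
    omega
  obtain ⟨z, hz, hz'⟩ := key {x, y} (lt_of_le_of_lt Finset.card_le_two (by norm_num))
  obtain ⟨w, hw, hw'⟩ := key {x, y, z} (lt_of_le_of_lt Finset.card_le_three (by norm_num))
  simp only [Finset.mem_insert, Finset.mem_singleton, not_or] at hz' hw'
  exact ⟨z, hz, w, hw, hz'.1, hz'.2, hw'.1, hw'.2.1, fun h => hw'.2.2 h.symm⟩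

theorem main_step (hS : S.Setting) {x a b y : P} (hxy : S.Collinear x y) (hxa : S.Perp x a)
    (hab : S.Perp a b) (hby : S.Perp b y) : ∃ p, S.Perp x p ∧ S.Perp p y := by
  by_cases hay : S.Perp a y
  · exact ⟨a, hxa, hay⟩
  by_cases hxb : S.Perp x b
  · exact ⟨b, hxb, hby⟩
  have hay' : S.Collinear a y := not_not.mp hay
  have hxb' : S.Collinear x b := not_not.mp hxb
  have hd := hS.2.2.2.2.1
  have hxa_ne : x ≠ a := by rintro rfl; exact hxb hab
  have hby_ne : b ≠ y := by rintro rfl; exact hay hab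
  obtain ⟨π, hπ, xπ, yπ, aπ⟩ := hd x y a hxy hay'.sm ⟨hxa_ne, hxa⟩
  obtain ⟨π', hπ', bπ', xπ', yπ'⟩ := hd b x y hxb'.sm hxy ⟨hby_ne, hby⟩
  obtain ⟨xy_ne, l, hl, xl, yl⟩ := id hxy
  obtain ⟨ay_ne, A, hA, aA, yA⟩ := id hay'
  obtain ⟨xb_ne, B, hB, xB, bB⟩ := id hxb'
  have lπ := plane_sub hπ hl xy_ne xl yl xπ yπ
  have lπ' := plane_sub hπ' hl xy_ne xl yl xπ' yπ'
  have Aπ := plane_sub hπ hA ay_ne aA yA aπ yπ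
  have Bπ' := plane_sub hπ' hB xb_ne xB bB xπ' bπ'
  obtain ⟨z, zl, w, wl, zx, zy, wx, wy, zw⟩ := four_points (hS.2.1 l hl) x y
  have hbπ : S.perpSet b ∩ π = A := setting_line hS hπ aπ yπ xπ hA aA yA ay_ne hab.sm hby
    (fun hc => hxb hc.sm)
  have haπ' : S.perpSet a ∩ π' = B := setting_line hS hπ' xπ' bπ' yπ' hB xB bB xb_ne hxa.sm hab hay
  have al : a ∉ l := fun hc => hxa_ne (perp_line hl xl hc hxa)
  have bl : b ∉ l := fun hc => hby_ne (perp_line hl hc yl hby)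
  have hBl : B ≠ l := by rintro rfl; exact bl bB
  -- d
  obtain ⟨d, dB, dz⟩ := tr_ex hπ' hB Bπ' (lπ' zl)
  have dx : d ≠ x := by rintro rfl; exact zx (perp_line hl zl xl dz.sm)
  have db : d ≠ b := by
    rintro rfl
    exact zy (tr_un hπ' hl lπ' bπ' zl yl dz.sm hby.sm)
  have hda : S.Perp d a := ((haπ'.symm.subset dB).1).sm
  have haz : S.Collinear a z := by
    by_contra hc
    exact zx (tr_un hπ hl lπ aπ zl xl (Perp.sm hc) hxa)
  obtain ⟨az_ne, C, hC, aC, zC⟩ := id haz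
  have Cπ := plane_sub hπ hC az_ne aC zC aπ (lπ zl)
  have hCl : C ≠ l := by rintro rfl; exact al aC
  have hdπ : S.perpSet d ∩ π = C := setting_line hS hπ aπ (lπ zl) xπ hC aC zC az_ne hda dz
    (fun hc => dx (perp_line hB dB xB hc))
  -- e
  obtain ⟨e, eC, ew⟩ := tr_ex hπ hC Cπ (lπ wl)
  have eπ := Cπ eC
  have hde : S.Perp d e := (hdπ.symm.subset eC).1
  have ea : e ≠ a := by
    rintro rfl
    exact wx (tr_un hπ hl lπ aπ wl xl ew.sm hxa)
  have el : e ∉ l := by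
    intro hc
    have : e = w := perp_line hl hc wl ew
    subst this
    exact hCl (S.unique_line _ hC _ hl z e zw zC eC zl hc)
  have hdw : S.Collinear d w := by
    by_contra hc
    exact zw (tr_un hπ' hl lπ' (Bπ' dB) zl wl dz.sm (Perp.sm hc))
  obtain ⟨dw_ne, D, hD, dD, wD⟩ := id hdw
  have Dπ' := plane_sub hπ' hD dw_ne dD wD (Bπ' dB) (lπ' wl)
  have heπ' : S.perpSet e ∩ π' = D := setting_line hS hπ' (Bπ' dB) (lπ' wl) xπ' hD dD wD dw_ne
    hde.sm ew (fun hc => wx (tr_un hπ hl lπ eπ wl xl ew.sm hc.sm))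
  have dl : d ∉ l := fun hc => dx (by
    by_contra hdx
    exact hBl (S.unique_line _ hB _ hl d x hdx dB xB hc xl))
  -- b'
  obtain ⟨b', b'D, b'y⟩ := tr_ex hπ' hD Dπ' yπ'
  have b'π' := Dπ' b'D
  have heb' : S.Perp e b' := (heπ'.symm.subset b'D).1
  have b'y_ne : b' ≠ y := by
    rintro rfl
    have := S.unique_line _ hD _ hl b' w wy.symm b'D wD yl wl
    exact dl (this ▸ dD)
  have b'b_ne : b' ≠ b := by
    rintro rfl
    have h1 := S.unique_line _ hD _ hB d b' db dD b'D dB bB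
    exact hBl (S.unique_line _ hB _ hl w x wx (h1 ▸ wD) xB wl xl)
  have hey : S.Collinear e y := by
    by_contra hc
    exact wy (tr_un hπ hl lπ eπ wl yl ew.sm (Perp.sm hc))
  obtain ⟨ey_ne, E, hE, eE, yE⟩ := id hey
  have Eπ := plane_sub hπ hE ey_ne eE yE eπ yπ
  have hb'a : S.Collinear b' a := by
    by_contra hc
    have : b' ∈ B := haπ'.subset ⟨Perp.sm hc, b'π'⟩
    exact b'b_ne (tr_un hπ' hB Bπ' yπ' this bB b'y hby)
  have hb'π : S.perpSet b' ∩ π = E := setting_line hS hπ eπ yπ aπ hE eE yE ey_ne heb'.sm b'y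
    (fun hc => hc hb'a)
  -- a'
  obtain ⟨a', a'E, a'x⟩ := tr_ex hπ hE Eπ xπ
  have a'π := Eπ a'E
  have hb'a' : S.Perp b' a' := (hb'π.symm.subset a'E).1
  have a'x_ne : a' ≠ x := by
    rintro rfl
    have := S.unique_line _ hE _ hl a' y xy_ne a'E yE xl yl
    exact el (this ▸ eE)
  have a'a_ne : a' ≠ a := by
    rintro rfl
    have h1 := S.unique_line _ hC _ hE a' e ea.symm aC eC a'E eE
    exact hCl (S.unique_line _ hC _ hl z y zy zC (h1 ▸ yE) zl yl)
  have ha'z : S.Collinear a' z := by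
    by_contra hc
    exact zx (tr_un hπ hl lπ a'π zl xl (Perp.sm hc) a'x.sm)
  have hzb' : S.Collinear z b' := by
    by_contra hc
    exact zy (tr_un hπ' hl lπ' b'π' zl yl hc b'y.sm)
  have hxb'' : S.Collinear x b' := by
    by_contra hc
    exact xy_ne (tr_un hπ' hl lπ' b'π' xl yl hc b'y.sm)
  have a'b'_ne : a' ≠ b' := by
    rintro rfl
    exact a'x hxb''.sm
  obtain ⟨ρ, hρ, a'ρ, zρ, b'ρ⟩ := hd a' z b' ha'z hzb' ⟨a'b'_ne, hb'a'.sm⟩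
  obtain ⟨a'z_ne, F, hF, a'F, zF⟩ := id ha'z
  obtain ⟨zb'_ne, G, hG, zG, b'G⟩ := id hzb'
  have Fπ := plane_sub hπ hF a'z_ne a'F zF a'π (lπ zl)
  have Fρ := plane_sub hρ hF a'z_ne a'F zF a'ρ zρ
  have Gπ' := plane_sub hπ' hG zb'_ne zG b'G (lπ' zl) b'π'
  have Gρ := plane_sub hρ hG zb'_ne zG b'G zρ b'ρ
  obtain ⟨g, gG, gx⟩ := tr_ex hπ' hG Gπ' xπ'
  have gb' : g ≠ b' := by rintro rfl; exact gx hxb''.sm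
  have ha'g : S.Collinear a' g := by
    by_contra hc
    exact gb' (tr_un hρ hG Gρ a'ρ gG b'G (Perp.sm hc) hb'a')
  obtain ⟨a'g_ne, H, hH, a'H, gH⟩ := id ha'g
  have hxz : ¬ S.Perp x z := fun hc => zx (perp_line hl zl xl hc.sm)
  have hxρ : S.perpSet x ∩ ρ = H := setting_line hS hρ a'ρ (Gρ gG) zρ hH a'H gH a'g_ne
    a'x.sm gx.sm hxz
  have haa' : S.Perp a' a := by
    intro hc
    obtain ⟨hne, m, hm, h1, h2⟩ := hc
    exact hne (tr_un hπ hm (plane_sub hπ hm hne h1 h2 a'π aπ) xπ h1 h2 a'x hxa.sm)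
  -- c
  obtain ⟨c, cF, cA⟩ := veblen hS hπ hA hC hE hF hbπ a'π haa' a'a_ne aA aC Cπ a'E a'F
    yE yA eE eC zF zC
  have ca' : c ≠ a' := by
    rintro rfl
    exact a'a_ne (perp_line hA cA aA haa')
  have hb'c : S.Collinear b' c := by
    by_contra hc
    exact ca' (tr_un hρ hF Fρ b'ρ cF a'F (Perp.sm hc) hb'a'.sm)
  obtain ⟨b'c_ne, K, hK, b'K, cK⟩ := id hb'c
  obtain ⟨k, kK, kH⟩ := veblen hS hρ hH hF hG hK hxρ b'ρ hb'a' a'b'_ne.symm a'H a'F Fρ b'G b'K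
    gG gH zG zF cK cF
  have hxk : S.Perp x k := (hxρ.symm.subset kH).1
  have ka' : k ≠ a' := by
    rintro rfl
    exact a'b'_ne (perp_line hK kK b'K hb'a'.sm)
  -- k and a are collinear
  have hka : S.Collinear k a := by
    by_contra hc
    have hca : a ∈ S.perpSet k ∩ π := ⟨hc, aπ⟩
    have hcx : x ∈ S.perpSet k ∩ π := ⟨hxk.sm, xπ⟩
    have hk' : ¬ S.Perp k a' := fun h => ka' (perp_line hH kH a'H h)
    rcases hS.2.2.2.2.2 k π hπ with h1 | ⟨q, h1⟩ | h1 | ⟨m, hm, hmπ, t, ht, h1⟩ | h1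
    · rw [h1] at hca; exact hca
    · rw [h1] at hca hcx
      exact hxa_ne (hcx.trans hca.symm)
    · exact hxa_ne (perp_line h1 hcx hca hxa)
    · have htx : S.Perp t x := (h1.subset hcx).1
      have hta' : S.Perp t a' := by
        intro hc'
        obtain ⟨hne, n, hn, h2, h3⟩ := hc'
        exact hne (tr_un hπ hn (plane_sub hπ hn hne h2 h3 (hmπ ht) a'π) xπ h2 h3 htx a'x)
      exact hk' (h1.symm.subset ⟨hta', a'π⟩).1
    · exact hk' (h1.symm.subset a'π).1
  obtain ⟨σ, hσ, yσ, aσ, b'σ⟩ := hd y a b' hay'.sm hb'a.sm ⟨b'y_ne.symm, b'y.sm⟩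
  have Aσ := plane_sub hσ hA ay_ne aA yA aσ yσ
  have Kσ := plane_sub hσ hK b'c_ne b'K cK b'σ (Aσ cA)
  obtain ⟨ka_ne, M, hM, kM, aM⟩ := id hka
  have hxσ : S.perpSet x ∩ σ = M := setting_line hS hσ (Kσ kK) aσ yσ hM kM aM ka_ne hxk hxa
    (fun hc => hc hxy)
  have Mσ := plane_sub hσ hM ka_ne kM aM (Kσ kK) aσ
  obtain ⟨p, pM, py⟩ := tr_ex hσ hM Mσ yσ
  exact ⟨p, (hxσ.symm.subset pM).1, py⟩

end PLS

/-- 3.8. In the Setting, the connected components of the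
graph `(P, ⊥)` have diameter at most `2`. -/
theorem perp_diameter_two {P : Type u} (S : PLS P) (h : S.Setting) :
    ∀ x y : P, Relation.ReflTransGen S.PerpAdj x y →
      x = y ∨ S.PerpAdj x y ∨ ∃ z, S.PerpAdj x z ∧ S.PerpAdj z y := by
  intro x y hxy
  have key : ∀ x a b y : P, S.Perp x a → S.Perp a b → S.Perp b y →
      x = y ∨ S.PerpAdj x y ∨ ∃ z, S.PerpAdj x z ∧ S.PerpAdj z y := by
    intro x a b y h1 h2 h3
    by_cases hc : S.Collinear x y
    · obtain ⟨p, hp1, hp2⟩ := PLS.main_step h hc h1 h2 h3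
      refine Or.inr (Or.inr ⟨p, ⟨?_, hp1⟩, ⟨?_, hp2⟩⟩)
      · rintro rfl; exact hp2 hc
      · rintro rfl; exact hp1 hc
    · by_cases he : x = y
      · exact Or.inl he
      · exact Or.inr (Or.inl ⟨he, hc⟩)
  induction hxy with
  | refl => exact Or.inl rfl
  | tail _ hbc ih =>
    rcases ih with rfl | hxb | ⟨z, hxz, hzb⟩
    · exact Or.inr (Or.inl hbc)
    · exact Or.inr (Or.inr ⟨_, hxb, hbc⟩)
    · exact key _ _ _ _ hxz.2 hzb.2 hbc.2
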